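/- Let M be a positive definite even unimodular lattice with an automorphism σ of odd prime order p, let V₀ be the fixed space of σ in V = M ⊗ ℚ and m₀ = dim V₀ > 0. If m₀ is not divisible by 8, then for every positive definite symmetric even integral m₀ × m₀ matrix S, the product det(S) · A(M,S) is divisible by p, where A(M,S) = #{(x₁,…,x_{m₀}) ∈ M^{m₀} : b(x_i,x_j) = S_{ij}}. -/

import Mathlib

open Complex in
noncomputable def gF (N : ℕ) (x : ZMod N) : ℂ := cexp (Real.pi * I * (x.val : ℂ) ^ 2 / N)

open Complex in
lemma gF_intCast (a : ℕ) (ha : 0 < a) (k : ℤ) :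
    gF (2 * a) (k : ZMod (2 * a)) = cexp (Real.pi * I * (k : ℂ) ^ 2 / ((2 * a : ℕ) : ℂ)) := by
  have : NeZero (2 * a) := ⟨by omega⟩
  have haC : (a : ℂ) ≠ 0 := by exact_mod_cast ha.ne'
  unfold gF
  have h1 : (((k : ZMod (2 * a)).val : ℤ)) = k % ((2 * a : ℕ) : ℤ) := ZMod.val_intCast k
  have h2 := Int.emod_add_mul_ediv k ((2 * a : ℕ) : ℤ)
  rw [← h1] at h2
  set r := (k : ZMod (2 * a)).val
  set j := k / ((2 * a : ℕ) : ℤ)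
  rw [Complex.exp_eq_exp_iff_exists_int]
  refine ⟨-(r * j + a * j ^ 2), ?_⟩
  have h3 : (k : ℂ) = r + 2 * a * j := by
    rw [← h2]; push_cast; ring
  rw [h3]
  push_cast
  field_simp
  ring

open Complex in
lemma theta_gauss_sum (a : ℕ) [NeZero (2 * a)] (ha : 0 < a) (y : ℂ) (hy : 0 < y.im) :
    ∑ k : ZMod (2 * a), gF (2 * a) k *
      jacobiTheta₂ ((k.val : ℂ) / ((2 * a : ℕ) : ℂ)) (1 / ((2 * a : ℕ) : ℂ) + y)
      = (∑ k : ZMod (2 * a), gF (2 * a) k) * jacobiTheta₂ 0 y := by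
  have haC : (a : ℂ) ≠ 0 := by exact_mod_cast ha.ne'
  have him : 0 < (1 / ((2 * a : ℕ) : ℂ) + y).im := by
    have : (1 / ((2 * a : ℕ) : ℂ)) = ((1 / (2 * a : ℕ) : ℝ) : ℂ) := by push_cast; rfl
    rw [this, add_im, ofReal_im, zero_add]; exact hy
  have h1 : HasSum (fun n : ℤ => ∑ k : ZMod (2 * a), gF (2 * a) k *
      jacobiTheta₂_term n ((k.val : ℂ) / ((2 * a : ℕ) : ℂ)) (1 / ((2 * a : ℕ) : ℂ) + y))
      (∑ k : ZMod (2 * a), gF (2 * a) k *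
      jacobiTheta₂ ((k.val : ℂ) / ((2 * a : ℕ) : ℂ)) (1 / ((2 * a : ℕ) : ℂ) + y)) :=
    hasSum_sum fun k _ => (hasSum_jacobiTheta₂_term _ him).mul_left _
  have h2 := (hasSum_jacobiTheta₂_term 0 hy).mul_left (∑ k : ZMod (2 * a), gF (2 * a) k)
  refine h1.unique ?_
  suffices hh : (fun n : ℤ => ∑ k : ZMod (2 * a), gF (2 * a) k *
      jacobiTheta₂_term n ((k.val : ℂ) / ((2 * a : ℕ) : ℂ)) (1 / ((2 * a : ℕ) : ℂ) + y)) =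
      fun n : ℤ => (∑ k : ZMod (2 * a), gF (2 * a) k) * jacobiTheta₂_term n 0 y by
    rw [hh]; exact h2
  funext n
  rw [← Equiv.sum_comp (Equiv.addRight (n : ZMod (2 * a))) (gF (2 * a)), Finset.sum_mul]
  refine Finset.sum_congr rfl fun k _ => ?_
  have hk : k = ((k.val : ℤ) : ZMod (2 * a)) := by simp
  simp only [Equiv.coe_addRight]
  have : gF (2 * a) (k + n) = gF (2 * a) (((k.val + n : ℤ)) : ZMod (2 * a)) := by
    congr 1; push_cast; simp
  rw [this, gF_intCast a ha]
  unfold gF jacobiTheta₂_term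
  rw [← Complex.exp_add, ← Complex.exp_add]
  congr 1
  push_cast
  field_simp
  ring

open Complex in
lemma jacobiTheta₂_add_even (z τ : ℂ) (a : ℕ) :
    jacobiTheta₂ z (τ + 2 * a) = jacobiTheta₂ z τ := by
  induction a with
  | zero => simp
  | succ n ih =>
    rw [← ih, ← jacobiTheta₂_add_right z (τ + 2 * n)]
    congr 1; push_cast; ring

open Complex in
lemma jacobiTheta₂_add_nat (z τ : ℂ) (a : ℕ) :
    jacobiTheta₂ (z + a) τ = jacobiTheta₂ z τ := by
  induction a with
  | zero => simp
  | succ n ih =>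
    rw [← ih, ← jacobiTheta₂_add_left (z + n) τ]
    congr 1; push_cast; ring

open Complex in
lemma theta_split (N : ℕ) [NeZero N] (τ : ℂ) (hτ : 0 < τ.im) :
    jacobiTheta₂ 0 τ = ∑ k : ZMod N, cexp (Real.pi * I * (k.val : ℂ) ^ 2 * τ) *
      jacobiTheta₂ (k.val * N * τ) (N ^ 2 * τ) := by
  obtain ⟨n, rfl⟩ : ∃ n, N = n + 1 := ⟨N - 1, by have := NeZero.pos N; omega⟩
  have hs := (hasSum_jacobiTheta₂_term 0 hτ)
  let e : Fin (n+1) × ℤ ≃ ℤ := (Equiv.prodComm _ _).trans (Int.divModEquiv (n+1)).symm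
  have hs2 := hs.summable
  rw [← e.summable_iff] at hs2
  unfold jacobiTheta₂
  rw [← e.tsum_eq]
  refine (Summable.tsum_prod hs2).trans ?_
  rw [tsum_fintype]
  change _ = ∑ k : Fin (n+1), _
  refine Finset.sum_congr rfl fun k _ => ?_
  rw [← tsum_mul_left]
  refine tsum_congr fun m => ?_
  have he : e (k, m) = m * (n+1 : ℕ) + (k : ℕ) := by
    simp [e, Int.divModEquiv]
  change jacobiTheta₂_term (e (k, m)) 0 τ = _
  rw [he]
  unfold jacobiTheta₂_term
  rw [← Complex.exp_add]
  congr 1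
  have : ZMod.val (n := n+1) k = (k : ℕ) := rfl
  rw [this]
  push_cast
  ring

open Complex in
lemma theta_I_ne_zero (y : ℝ) (hy : 0 < y) : jacobiTheta₂ 0 (I * y) ≠ 0 := by
  have him : 0 < (I * y : ℂ).im := by simpa using hy
  have hs := (hasSum_jacobiTheta₂_term 0 him)
  have h2 := Complex.hasSum_re hs
  have : 0 < (jacobiTheta₂ 0 (I * y)).re := by
    have hterm : ∀ n : ℤ, (jacobiTheta₂_term n 0 (I * y)).re = Real.exp (-Real.pi * n^2 * y) := by
      intro n
      unfold jacobiTheta₂_term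
      have : (2 * Real.pi * I * n * 0 + Real.pi * I * (n:ℂ)^2 * (I * y)) = ((-Real.pi * n^2*y : ℝ) : ℂ) := by
        push_cast; ring_nf; rw [I_sq]; ring
      rw [this, Complex.exp_ofReal_re]
    simp only [hterm] at h2
    rw [← h2.tsum_eq]
    exact h2.summable.tsum_pos (fun n => (Real.exp_pos _).le) 0 (Real.exp_pos _)
  intro h
  rw [h] at this
  simp at this

open Complex in
lemma gauss_sum_eval (a : ℕ) [NeZero (2 * a)] (ha : 0 < a) :
    ∃ r : ℝ, 0 < r ∧ ∑ k : ZMod (2 * a), gF (2 * a) k = r * (1 + I) := by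
  have haC : (a : ℂ) ≠ 0 := by exact_mod_cast ha.ne'
  have haR : (0 : ℝ) < a := by exact_mod_cast ha
  have hI := Complex.I_ne_zero
  have h1I : (1 + I : ℂ) ≠ 0 := by intro h; have := congrArg Complex.re h; simp at this
  have hII : I * I = -1 := I_mul_I
  have ha4 : (0 : ℝ) < 1 / (4 * a) := by positivity
  obtain ⟨τ, hτdef⟩ : ∃ τ : ℂ, τ = (1 + I) / (4 * a) := ⟨_, rfl⟩
  have hτ' : τ = ((1 / (4 * a) : ℝ) : ℂ) * (1 + I) := by
    rw [hτdef]; push_cast; field_simp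
  have hτim : 0 < τ.im := by
    rw [hτ', im_ofReal_mul]; simpa using ha
  have hτre : 0 < τ.re := by
    rw [hτ', re_ofReal_mul]; simpa using ha
  have hτ0 : τ ≠ 0 := by intro h; rw [h] at hτim; simp at hτim
  have harg : τ.arg ≠ Real.pi := by
    intro h; rw [Complex.arg_eq_pi_iff] at h; linarith [h.1]
  have hconj : -I * τ = (starRingEnd ℂ) τ := by
    rw [hτ', map_mul, conj_ofReal, map_add, map_one, conj_I]
    linear_combination (-((1 / (4 * a) : ℝ) : ℂ)) * hII
  have e1 : -1 / τ + 2 * a = I * ((2 * a : ℝ) : ℂ) := by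
    rw [hτdef]; push_cast; field_simp
    linear_combination (-2 : ℂ) * hII
  have f1 : jacobiTheta₂ 0 τ = 1 / (-I * τ) ^ (1 / 2 : ℂ) *
      (1 / ((2 * a : ℝ) : ℂ) ^ (1 / 2 : ℂ) * jacobiTheta₂ 0 (I * ((1 / (2 * a) : ℝ) : ℂ))) := by
    rw [jacobiTheta₂_functional_equation 0 τ, ← jacobiTheta₂_add_even _ (-1 / τ) a, e1,
      zero_div, jacobiTheta₂_functional_equation 0 (I * ((2 * a : ℝ) : ℂ))]
    have x1 : -I * (I * ((2 * a : ℝ) : ℂ)) = ((2 * a : ℝ) : ℂ) := by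
      linear_combination (-((2 * a : ℝ) : ℂ)) * hII
    have x2 : -1 / (I * ((2 * a : ℝ) : ℂ)) = I * ((1 / (2 * a) : ℝ) : ℂ) := by
      push_cast; field_simp; linear_combination (-1 : ℂ) * hII
    rw [x1, x2]
    simp
  have f2 : jacobiTheta₂ 0 τ = 1 / (((4 * a ^ 2 : ℝ) : ℂ) * τ) ^ (1 / 2 : ℂ) *
      ((∑ k : ZMod (2 * a), gF (2 * a) k) * jacobiTheta₂ 0 (I * ((1 / (2 * a) : ℝ) : ℂ))) := by
    rw [theta_split (2 * a) τ hτim, ← theta_gauss_sum a ha, Finset.mul_sum]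
    · refine Finset.sum_congr rfl fun k _ => ?_
      obtain ⟨w, hw⟩ : ∃ w : ℂ, w = a * (I - 1) := ⟨_, rfl⟩
      have hI1 : I - 1 ≠ 0 := by intro h; have := congrArg Complex.re h; simp at this
      have hw0 : w ≠ 0 := by rw [hw]; exact mul_ne_zero haC hI1
      have y1 : (((2 * a : ℕ) : ℂ) ^ 2 * τ) = w + 2 * a := by
        rw [hτdef, hw]; push_cast; field_simp; ring
      have y2 : (k.val : ℂ) * ((2 * a : ℕ) : ℂ) * τ = k.val * w / (2 * a) + (k.val : ℕ) := by
        rw [hτdef, hw]; push_cast; field_simp; ring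
      have y3 : -I * w = ((4 * a ^ 2 : ℝ) : ℂ) * τ := by
        rw [hτdef, hw]; push_cast; field_simp; linear_combination (-1 : ℂ) * hII
      have y4 : -1 / w = 1 / ((2 * a : ℕ) : ℂ) + I * ((1 / (2 * a) : ℝ) : ℂ) := by
        rw [hw]; push_cast; field_simp; linear_combination (-1 : ℂ) * hII
      have y5 : (k.val * w / (2 * a)) / w = (k.val : ℂ) / ((2 * a : ℕ) : ℂ) := by
        push_cast; field_simp
      rw [y1, y2, jacobiTheta₂_add_even, jacobiTheta₂_add_nat, jacobiTheta₂_functional_equation,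
        y3, y4, y5]
      have y6 : cexp (Real.pi * I * (k.val : ℂ) ^ 2 * τ) *
          cexp (-Real.pi * I * (k.val * w / (2 * a)) ^ 2 / w) = gF (2 * a) k := by
        unfold gF
        rw [← Complex.exp_add]
        congr 1
        rw [hτdef]
        have : (k.val * w / (2 * a)) ^ 2 / w = (k.val : ℂ) ^ 2 * w / (4 * a ^ 2) := by
          field_simp; ring
        rw [mul_div_assoc, this, hw]
        push_cast; field_simp; ring
      rw [← y6]; ring
    · simpa using ha
  have hθ := theta_I_ne_zero (1 / (2 * a)) (by positivity)
  have f3 := f1.symm.trans f2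
  set G := ∑ k : ZMod (2 * a), gF (2 * a) k
  set θ := jacobiTheta₂ 0 (I * ((1 / (2 * a) : ℝ) : ℂ))
  have ht : (-I * τ) ^ (1 / 2 : ℂ) = (starRingEnd ℂ) (τ ^ (1 / 2 : ℂ)) := by
    rw [hconj, Complex.conj_cpow _ _ harg]
    congr 2
    have : (1 / 2 : ℂ) = ((1 / 2 : ℝ) : ℂ) := by push_cast; rfl
    rw [this, conj_ofReal]
  have hu : ((2 * a : ℝ) : ℂ) ^ (1 / 2 : ℂ) = (((2 * a : ℝ) ^ (1 / 2 : ℝ) : ℝ) : ℂ) := by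
    rw [Complex.ofReal_cpow (by positivity)]; push_cast; rfl
  have hpos4 : (0 : ℝ) < 4 * a ^ 2 := by positivity
  have hs : (((4 * a ^ 2 : ℝ) : ℂ) * τ) ^ (1 / 2 : ℂ) =
      (((4 * a ^ 2 : ℝ) ^ (1 / 2 : ℝ) : ℝ) : ℂ) * τ ^ (1 / 2 : ℂ) := by
    rw [Complex.ofReal_cpow hpos4.le, Complex.cpow_def_of_ne_zero, Complex.cpow_def_of_ne_zero hτ0,
      Complex.cpow_def_of_ne_zero (by exact_mod_cast hpos4.ne'), ← Complex.exp_add,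
      Complex.log_ofReal_mul hpos4 hτ0, Complex.ofReal_log hpos4.le]
    · congr 1; push_cast; ring
    · exact mul_ne_zero (by exact_mod_cast hpos4.ne') hτ0
  have hsq : (τ ^ (1 / 2 : ℂ)) * (τ ^ (1 / 2 : ℂ)) = τ := by
    rw [← Complex.cpow_add _ _ hτ0]; norm_num
  rw [ht, hu, hs] at f3
  have hup : 0 < ((2 * a : ℝ) ^ (1 / 2 : ℝ) : ℝ) := by positivity
  have hvp : 0 < ((4 * a ^ 2 : ℝ) ^ (1 / 2 : ℝ) : ℝ) := by positivity
  set u := ((2 * a : ℝ) ^ (1 / 2 : ℝ) : ℝ)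
  set v := ((4 * a ^ 2 : ℝ) ^ (1 / 2 : ℝ) : ℝ)
  set s := τ ^ (1 / 2 : ℂ)
  have hs0 : s ≠ 0 := by intro h; rw [h] at hsq; simp at hsq; exact hτ0 hsq.symm
  have hn : 0 < Complex.normSq s := Complex.normSq_pos.mpr hs0
  have hcs : s * (starRingEnd ℂ) s = (Complex.normSq s : ℂ) := Complex.mul_conj s
  have hcs0 : (starRingEnd ℂ) s ≠ 0 := by simpa using hs0
  refine ⟨v / (u * Complex.normSq s) * (1 / (4 * a)), by positivity, ?_⟩
  have huC : (u : ℂ) ≠ 0 := by exact_mod_cast hup.ne'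
  have hvC : (v : ℂ) ≠ 0 := by exact_mod_cast hvp.ne'
  have hnC : (Complex.normSq s : ℂ) ≠ 0 := by exact_mod_cast hn.ne'
  have f4 : v * s = (starRingEnd ℂ) s * u * G := by
    field_simp at f3
    exact f3
  have f5 : G = v / (u * Complex.normSq s) * τ := by
    rw [← hcs, ← hsq]
    field_simp
    first | linear_combination f4 | linear_combination -f4
  rw [f5, hτ']
  push_cast; ring

lemma isotropic_sum {D : Type*} [AddCommGroup D] [Fintype D] (Q : D → ℂ)
    (H : AddSubgroup D)
    (h1 : ∀ x, ∀ h ∈ H, ∀ h' ∈ H, Q (x + h + h') * Q x = Q (x + h) * Q (x + h'))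
    (hH : ∀ h ∈ H, Q h = 1) (hperp : ∀ x, (∀ h ∈ H, Q (x + h) = Q x) → x ∈ H) :
    ∑ x, Q x = (Nat.card H : ℂ) := by
  classical
  have key : ∀ x, ∑ h : H, Q (x + h) = if x ∈ H then (Nat.card H : ℂ) else 0 := by
    intro x
    split_ifs with hx
    · rw [Finset.sum_congr rfl (fun h _ => hH _ (H.add_mem hx h.2))]
      simp
    · have : ∃ h ∈ H, Q (x + h) ≠ Q x := by
        by_contra hc
        push Not at hc
        exact hx (hperp x hc)
      obtain ⟨h0, hh0, hne⟩ := this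
      have e : (∑ h : H, Q (x + h)) * Q x = (∑ h : H, Q (x + h)) * Q (x + h0) := by
        rw [← Equiv.sum_comp (Equiv.addRight (⟨h0, hh0⟩ : H)) (fun h : H => Q (x + h)),
          Finset.sum_mul, Equiv.sum_comp (Equiv.addRight (⟨h0, hh0⟩ : H)) (fun h : H => Q (x + h)),
          Finset.sum_mul]
        refine Finset.sum_congr rfl fun h _ => ?_
        have := h1 x h h.2 h0 hh0
        simpa [add_assoc] using this
      by_contra hS
      exact hne (mul_left_cancel₀ hS e).symm
  have tot : ∑ x, ∑ h : H, Q (x + h) = (Nat.card H : ℂ) * ∑ x, Q x := by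
    rw [Finset.sum_comm]
    have : ∀ h : H, ∑ x, Q (x + h) = ∑ x, Q x := fun h =>
      Equiv.sum_comp (Equiv.addRight (h : D)) Q
    simp [this]
  rw [Finset.sum_congr rfl (fun x _ => key x)] at tot
  have h0 : (Nat.card H : ℂ) ≠ 0 := by
    exact_mod_cast Nat.card_pos.ne'
  have : ∑ x : D, (if x ∈ H then (Nat.card H : ℂ) else 0) = (Nat.card H : ℂ) * Nat.card H := by
    rw [← Finset.sum_filter, Finset.sum_const, nsmul_eq_mul]
    congr 2
    rw [Nat.card_eq_fintype_card, Fintype.card_subtype]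
  rw [this] at tot
  exact (mul_left_cancel₀ h0 tot).symm

open Complex in
lemma eight_dvd_of_pow (n : ℕ) (R c : ℝ) (hR : 0 < R) (hc : 0 < c)
    (h : (R : ℂ) * (1 + I) ^ n = c) : 8 ∣ n := by
  have h8 : (1 + I) ^ 8 = (16 : ℂ) := by
    have : (1 + I) ^ 2 = 2 * I := by ring_nf; rw [I_sq]; ring
    calc (1 + I) ^ 8 = ((1 + I) ^ 2) ^ 4 := by ring
      _ = 16 := by rw [this, mul_pow, I_pow_four]; norm_num
  have hn := Nat.div_add_mod n 8
  have hlt := Nat.mod_lt n (by norm_num : 8 > 0)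
  set s := n % 8 with hs
  set t := n / 8
  rw [← hn, pow_add, pow_mul, h8, ← mul_assoc] at h
  have hcast : (R : ℂ) * 16 ^ t = ((R * 16 ^ t : ℝ) : ℂ) := by push_cast; rfl
  have hpos : 0 < R * 16 ^ t := by positivity
  rw [hcast] at h
  generalize R * 16 ^ t = u at h hpos
  have hre := congrArg Complex.re h
  have him := congrArg Complex.im h
  rw [re_ofReal_mul] at hre
  rw [im_ofReal_mul] at him
  apply Nat.dvd_of_mod_eq_zero
  rw [← hs]
  clear_value s t
  interval_cases s
  · rfl
  all_goals exfalso; simp [pow_succ] at hre him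
  all_goals first | linarith | (rcases him with h | h <;> norm_num at h <;> linarith)

open Complex in
lemma cexp_rat_eq (s t : ℚ) :
    cexp (2 * Real.pi * I * s) = cexp (2 * Real.pi * I * t) ↔ ∃ n : ℤ, s = t + n := by
  rw [Complex.exp_eq_exp_iff_exists_int]
  refine exists_congr fun n => ?_
  have hpi : (2 * Real.pi * I : ℂ) ≠ 0 := Complex.two_pi_I_ne_zero
  constructor
  · intro h
    have : (s : ℂ) = t + n := by
      apply mul_left_cancel₀ hpi
      rw [h]; ring
    exact_mod_cast this
  · intro h
    rw [h]; push_cast; ring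

lemma exists_mul_mem {W : Type*} [AddCommGroup W] [Module ℚ W] (L : AddSubgroup W)
    (hL : Submodule.span ℚ (L : Set W) = ⊤) (x : W) : ∃ c : ℕ, 0 < c ∧ (c : ℚ) • x ∈ L := by
  have hx : x ∈ Submodule.span ℚ (L : Set W) := by rw [hL]; trivial
  induction hx using Submodule.span_induction with
  | mem x h => exact ⟨1, one_pos, by simpa using h⟩
  | zero => exact ⟨1, one_pos, by simp⟩
  | add x y _ _ hx hy =>
    obtain ⟨c, hc, h1⟩ := hx
    obtain ⟨d, hd, h2⟩ := hy
    refine ⟨c * d, Nat.mul_pos hc hd, ?_⟩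
    have e : ((c * d : ℕ) : ℚ) • (x + y) = d • ((c : ℚ) • x) + c • ((d : ℚ) • y) := by
      rw [← Nat.cast_smul_eq_nsmul ℚ, ← Nat.cast_smul_eq_nsmul ℚ, smul_smul, smul_smul]
      push_cast
      rw [smul_add, mul_comm (d : ℚ)]
    rw [e]
    exact L.add_mem (L.nsmul_mem h1 _) (L.nsmul_mem h2 _)
  | smul r x _ hx =>
    obtain ⟨c, hc, h1⟩ := hx
    refine ⟨c * r.den, Nat.mul_pos hc r.den_pos, ?_⟩
    have e : ((c * r.den : ℕ) : ℚ) • (r • x) = r.num • ((c : ℚ) • x) := by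
      rw [← Int.cast_smul_eq_zsmul ℚ, smul_smul, smul_smul]
      congr 1
      push_cast
      have := Rat.mul_den_eq_num r
      linear_combination (c : ℚ) * this
    rw [e]
    exact L.zsmul_mem h1 _

open Complex in
theorem eight_dvd_finrank {W : Type*} [AddCommGroup W] [Module ℚ W] [FiniteDimensional ℚ W]
    (q : QuadraticForm ℚ W) (hqpos : ∀ v : W, v ≠ 0 → 0 < q v) (L : AddSubgroup W)
    (hL : Submodule.span ℚ (L : Set W) = ⊤)
    (hint : ∀ x ∈ L, ∃ n : ℤ, q x = (n : ℚ))
    (hdual : ∀ x : W, (∀ y ∈ L, ∃ n : ℤ, QuadraticMap.polar q x y = (n : ℚ)) → x ∈ L) :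
    8 ∣ Module.finrank ℚ W := by
  classical
  obtain ⟨B, hB⟩ : ∃ B : LinearMap.BilinForm ℚ W, ∀ x y, B x y = QuadraticMap.polar q x y :=
    ⟨QuadraticMap.polarBilin q, fun _ _ => rfl⟩
  have hself : ∀ x, B x x = 2 * q x := by
    intro x
    rw [hB, QuadraticMap.polar_self, two_nsmul, two_mul]
  have hcomm : ∀ x y, B x y = B y x := by
    intro x y; rw [hB, hB, QuadraticMap.polar_comm]
  have hqadd : ∀ x y, q (x + y) = q x + q y + B x y := by
    intro x y; rw [hB, QuadraticMap.polar]; ring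
  have hBint : ∀ x ∈ L, ∀ y ∈ L, ∃ n : ℤ, B x y = n := by
    intro x hx y hy
    obtain ⟨n1, h1⟩ := hint x hx
    obtain ⟨n2, h2⟩ := hint y hy
    obtain ⟨n3, h3⟩ := hint _ (L.add_mem hx hy)
    refine ⟨n3 - n1 - n2, ?_⟩
    have := hqadd x y
    push_cast
    rw [← h1, ← h2, ← h3]
    linarith
  obtain ⟨v, hv⟩ := LinearMap.BilinForm.exists_orthogonal_basis (B := B) ⟨hcomm⟩
  generalize Module.finrank ℚ W = n at v hv ⊢
  have hvo : ∀ i j, i ≠ j → B (v i) (v j) = 0 := fun i j hij => hv hij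
  choose c hc hcL using fun i => exists_mul_mem L hL (v i)
  have hc0 : ∀ i, (c i : ℚ) ≠ 0 := fun i => by exact_mod_cast (hc i).ne'
  let e : Module.Basis (Fin n) ℚ W := v.isUnitSMul (w := fun i => (c i : ℚ)) (fun i => (hc0 i).isUnit)
  have he : ∀ i, e i = (c i : ℚ) • v i := fun i => v.isUnitSMul_apply _ i
  have heL : ∀ i, e i ∈ L := fun i => by rw [he]; exact hcL i
  have heo : ∀ i j, i ≠ j → B (e i) (e j) = 0 := by
    intro i j hij
    simp [he, hvo i j hij]
  have ha' : ∀ i, ∃ a : ℕ, 0 < a ∧ q (e i) = a := by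
    intro i
    obtain ⟨m, hm⟩ := hint _ (heL i)
    have hp := hqpos _ (e.ne_zero i)
    rw [hm] at hp
    have hp' : 0 < m := by exact_mod_cast hp
    obtain ⟨a, rfl⟩ := Int.eq_ofNat_of_zero_le hp'.le
    exact ⟨a, by exact_mod_cast hp', by rw [hm]; simp⟩
  choose a ha hqa using ha'
  clear_value e
  have haQ : ∀ i, (a i : ℚ) ≠ 0 := fun i => by exact_mod_cast (ha i).ne'
  have : ∀ i, NeZero (2 * a i) := fun i => ⟨by have := ha i; omega⟩
  let φ : (Fin n → ℤ) →+ W := AddMonoidHom.mk' (fun k => ∑ i, ((k i : ℚ) / (2 * a i)) • e i) (by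
    intro k l
    rw [← Finset.sum_add_distrib]
    refine Finset.sum_congr rfl fun i _ => ?_
    rw [← add_smul]; congr 1; simp only [Pi.add_apply]; push_cast; ring)
  have hφ : ∀ k, φ k = ∑ i, ((k i : ℚ) / (2 * a i)) • e i := fun k => rfl
  let D := ∀ i, ZMod (2 * a i)
  let C : (Fin n → ℤ) →+ D := AddMonoidHom.mk' (fun k i => (k i : ZMod (2 * a i))) (by
    intro k l; funext i; exact Int.cast_add _ _)
  have hCsurj : Function.Surjective C := fun x =>
    ⟨fun i => ((x i).val : ℤ), by funext i; simp [C]⟩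
  let Q : D → ℂ := fun x => ∏ i, gF (2 * a i) (x i)
  have hφe : ∀ k j, B (φ k) (e j) = k j := by
    intro k j
    rw [hφ, map_sum, LinearMap.sum_apply, Finset.sum_eq_single j]
    · rw [map_smul, LinearMap.smul_apply, hself, hqa, smul_eq_mul]
      have := haQ j
      field_simp
    · intro i _ hij
      rw [map_smul, LinearMap.smul_apply, heo i j hij, smul_zero]
    · simp
  have hqφ : ∀ k, q (φ k) = ∑ i, (k i : ℚ) ^ 2 / (4 * a i) := by
    intro k
    have h2 : B (φ k) (φ k) = ∑ i, (k i : ℚ) ^ 2 / (2 * a i) := by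
      conv_lhs => rw [hφ k, map_sum, ← hφ k]
      simp only [map_smul]
      refine Finset.sum_congr rfl fun i _ => ?_
      rw [hφe, smul_eq_mul]; ring
    rw [hself] at h2
    have h3 : q (φ k) = (∑ i, (k i : ℚ) ^ 2 / (2 * a i)) / 2 := by linarith
    rw [h3, Finset.sum_div]
    refine Finset.sum_congr rfl fun i _ => ?_
    have := haQ i
    field_simp
    norm_num
  have hQC : ∀ k, Q (C k) = cexp (2 * Real.pi * I * (q (φ k) : ℚ)) := by
    intro k
    have : Q (C k) = ∏ i, gF (2 * a i) ((k i : ℤ) : ZMod (2 * a i)) := rfl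
    rw [this, Finset.prod_congr rfl (fun i _ => gF_intCast (a i) (ha i) (k i)), ← Complex.exp_sum,
      hqφ]
    congr 1
    push_cast
    rw [Finset.mul_sum]
    refine Finset.sum_congr rfl fun i _ => ?_
    have : (a i : ℂ) ≠ 0 := by exact_mod_cast (ha i).ne'
    field_simp
    norm_num
  have hLφ : ∀ y ∈ L, ∃ l, φ l = y := by
    intro y hy
    choose l hl using fun i => hBint y hy (e i) (heL i)
    refine ⟨l, ?_⟩
    rw [hφ, ← e.sum_repr y]
    refine Finset.sum_congr rfl fun j _ => ?_
    congr 1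
    have h2 := hl j
    rw [← e.sum_repr y, map_sum, LinearMap.sum_apply, Finset.sum_eq_single j] at h2
    · rw [map_smul, LinearMap.smul_apply, hself, hqa, smul_eq_mul] at h2
      rw [← h2]
      have := haQ j
      field_simp
    · intro i _ hij
      rw [map_smul, LinearMap.smul_apply, heo i j hij, smul_zero]
    · simp
  let H : AddSubgroup D := (L.comap φ).map C
  have hsum : ∑ x, Q x = (Nat.card H : ℂ) := by
    apply isotropic_sum
    · intro x h hh h' hh'
      obtain ⟨k, rfl⟩ := hCsurj x
      obtain ⟨l, hl, rfl⟩ := hh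
      obtain ⟨l', hl', rfl⟩ := hh'
      have hl : φ l ∈ L := hl
      have hl' : φ l' ∈ L := hl'
      rw [← map_add, ← map_add, ← map_add, hQC, hQC, hQC, hQC, ← Complex.exp_add,
        ← Complex.exp_add, ← mul_add, ← mul_add]
      obtain ⟨m, hm⟩ := hBint _ hl _ hl'
      have := (cexp_rat_eq (q (φ (k + l + l')) + q (φ k)) (q (φ (k + l)) + q (φ (k + l')))).mpr
        ⟨m, by
          rw [← hm]; simp only [map_add, hqadd, LinearMap.add_apply]; ring⟩
      push_cast at this
      exact this
    · intro h hh
      obtain ⟨l, hl, rfl⟩ := hh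
      obtain ⟨m, hm⟩ := hint _ (show φ l ∈ L from hl)
      rw [hQC, hm]
      have := (cexp_rat_eq m 0).mpr ⟨m, by simp⟩
      rw [this]; simp
    · intro x hx
      obtain ⟨k, rfl⟩ := hCsurj x
      refine ⟨k, ?_, rfl⟩
      change φ k ∈ L
      apply hdual
      intro y hy
      obtain ⟨l, rfl⟩ := hLφ y hy
      have h1 := hx (C l) ⟨l, hy, rfl⟩
      rw [← map_add, hQC, hQC, cexp_rat_eq] at h1
      obtain ⟨m, hm⟩ := h1
      obtain ⟨m', hm'⟩ := hint _ hy
      rw [map_add, hqadd, hm'] at hm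
      refine ⟨m - m', ?_⟩
      rw [← hB]; push_cast; linarith
  have hprod : ∑ x, Q x = ∏ i, ∑ k : ZMod (2 * a i), gF (2 * a i) k := by
    rw [Finset.prod_univ_sum]
    simp [Q, D]
  choose r hr hrG using fun i => gauss_sum_eval (a i) (ha i)
  rw [hprod, Finset.prod_congr rfl (fun i _ => hrG i), Finset.prod_mul_distrib, Finset.prod_const,
    Finset.card_univ, Fintype.card_fin] at hsum
  refine eight_dvd_of_pow n (∏ i, r i) (Nat.card H) (Finset.prod_pos fun i _ => hr i)
    (by exact_mod_cast Nat.card_pos) ?_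
  push_cast
  exact hsum

/-- Let `M` be a positive definite even unimodular lattice with an automorphism `σ` of odd
prime order `p`, let `V₀` be the fixed space of `σ` in `V = M ⊗ ℚ` and `m₀ = dim V₀ > 0`.
If `m₀` is not divisible by `8`, then for every positive definite symmetric even integral
`m₀ × m₀` matrix `S`, the product `det S * A(M, S)` is divisible by `p`, where
`A(M, S) = #{(x₁, …, x_{m₀}) ∈ M^{m₀} : b (xᵢ) (xⱼ) = Sᵢⱼ}` (with
`b = QuadraticMap.polar q`). -/
theorem theta_operator_vanishes_mod_p_of_not_eight_dvd
    (V : Type*) [AddCommGroup V] [Module ℚ V] [FiniteDimensional ℚ V]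
    (q : QuadraticForm ℚ V) (hqpos : ∀ v : V, v ≠ 0 → 0 < q v)
    (p : ℕ) (hp : p.Prime) (hodd : Odd p)
    (σ : V ≃ₗ[ℚ] V) (hσq : ∀ v : V, q (σ v) = q v) (hσp : σ ^ p = 1)
    (M : Submodule ℤ V) (hMfg : M.FG) (hMfull : Submodule.span ℚ (M : Set V) = ⊤)
    -- `M` is integral with respect to `q`, i.e. even integral with respect to `b`
    (hMint : ∀ x ∈ M, ∃ n : ℤ, q x = (n : ℚ))
    -- `M` is unimodular with respect to `b`, i.e. `M^# ⊆ M`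
    (hMunimod : ∀ x : V, (∀ y ∈ M, ∃ n : ℤ, QuadraticMap.polar q x y = (n : ℚ)) → x ∈ M)
    (hσM : ∀ x ∈ M, σ x ∈ M)
    (V₀ : Submodule ℚ V) (hV₀ : ∀ v : V, v ∈ V₀ ↔ σ v = v)
    (m₀ : ℕ) (hm₀ : m₀ = Module.finrank ℚ V₀) (hm₀pos : 0 < m₀)
    (hm₀8 : ¬ 8 ∣ m₀)
    (S : Matrix (Fin m₀) (Fin m₀) ℤ) (hSsymm : S.IsSymm)
    (hSpos : (S.map ((↑) : ℤ → ℚ)).PosDef) (hSeven : ∀ i, 2 ∣ S i i) :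
    (p : ℤ) ∣ S.det * (Nat.card {x : Fin m₀ → V // (∀ i, x i ∈ M) ∧
        ∀ i j, QuadraticMap.polar q (x i) (x j) = (S i j : ℚ)} : ℤ) := by
  classical
  by_cases hdiv : (p : ℤ) ∣ S.det
  · exact hdiv.mul_right _
  apply Dvd.dvd.mul_left
  rw [Int.natCast_dvd_natCast]
  by_contra hcard
  have hpF : Fact p.Prime := ⟨hp⟩
  have hfin : Finite {x : Fin m₀ → V // (∀ i, x i ∈ M) ∧
        ∀ i j, QuadraticMap.polar q (x i) (x j) = (S i j : ℚ)} := by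
    apply Nat.finite_of_card_ne_zero
    intro h; rw [h] at hcard; simp at hcard
  have hpolσ : ∀ x y, QuadraticMap.polar q (σ x) (σ y) = QuadraticMap.polar q x y := by
    intro x y
    simp only [QuadraticMap.polar, ← map_add, hσq]
  -- a fixed tuple
  obtain ⟨x, hxM, hxS, hxσ⟩ : ∃ x : Fin m₀ → V, (∀ i, x i ∈ M) ∧
      (∀ i j, QuadraticMap.polar q (x i) (x j) = (S i j : ℚ)) ∧ ∀ i, σ (x i) = x i := by
    have := Fintype.ofFinite {x : Fin m₀ → V // (∀ i, x i ∈ M) ∧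
        ∀ i j, QuadraticMap.polar q (x i) (x j) = (S i j : ℚ)}
    let f : Function.End {x : Fin m₀ → V // (∀ i, x i ∈ M) ∧
        ∀ i j, QuadraticMap.polar q (x i) (x j) = (S i j : ℚ)} :=
      fun x => ⟨fun i => σ (x.1 i), fun i => hσM _ (x.2.1 i), fun i j => by
        rw [hpolσ]; exact x.2.2 i j⟩
    have hf : ∀ k : ℕ, ∀ x i, ((f ^ k) x).1 i = (σ ^ k) (x.1 i) := by
      intro k
      induction k with
      | zero => intro x i; rfl
      | succ k ih =>
        intro x i
        rw [pow_succ', pow_succ', LinearEquiv.mul_apply, ← ih]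
        rfl
    have hfp : f ^ p ^ 1 = 1 := by
      funext x
      apply Subtype.ext
      funext i
      rw [pow_one, hf, hσp]
      rfl
    have hmod := Equiv.Perm.card_fixedPoints_modEq hfp
    by_contra hne
    have hemp : IsEmpty f.fixedPoints := ⟨fun x => hne ⟨x.1.1, x.1.2.1, x.1.2.2, fun i => by
      have h : f x.1 = x.1 := x.2
      exact congrFun (congrArg Subtype.val h) i⟩⟩
    rw [Fintype.card_eq_zero (α := f.fixedPoints), Nat.modEq_zero_iff_dvd,
      ← Nat.card_eq_fintype_card] at hmod
    exact hcard hmod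
  let q' : QuadraticForm ℚ V₀ := q.comp V₀.subtype
  have hpol' : ∀ y z : V₀, QuadraticMap.polar q' y z = QuadraticMap.polar q (y : V) z :=
    fun y z => rfl
  let L : AddSubgroup V₀ := M.toAddSubgroup.comap V₀.subtype.toAddMonoidHom
  have hLmem : ∀ y : V₀, y ∈ L ↔ (y : V) ∈ M := fun y => Iff.rfl
  let x' : Fin m₀ → V₀ := fun i => ⟨x i, (hV₀ _).mpr (hxσ i)⟩
  have hx'S : ∀ i j, QuadraticMap.polarBilin q' (x' i) (x' j) = (S i j : ℚ) := hxS
  have hdet0 : S.det ≠ 0 := fun h => hdiv (by rw [h]; exact dvd_zero _)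
  let SQ : Matrix (Fin m₀) (Fin m₀) ℚ := S.map (Int.castRingHom ℚ)
  have hSQdet : SQ.det = (S.det : ℚ) := ((Int.castRingHom ℚ).map_det S).symm
  have hSQ0 : SQ.det ≠ 0 := by rw [hSQdet]; exact_mod_cast hdet0
  have hgram : ∀ (c : Fin m₀ → ℚ) (j : Fin m₀),
      QuadraticMap.polarBilin q' (x' j) (∑ i, c i • x' i) = (SQ.mulVec c) j := by
    intro c j
    rw [map_sum]
    refine Finset.sum_congr rfl fun i _ => ?_
    rw [map_smul, hx'S, smul_eq_mul, mul_comm]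
    rfl
  have hli : LinearIndependent ℚ x' := by
    rw [Fintype.linearIndependent_iff]
    intro c hc
    have : SQ.mulVec c = 0 := by
      funext j
      rw [← hgram, hc, map_zero]; rfl
    exact congrFun (Matrix.eq_zero_of_mulVec_eq_zero hSQ0 this)
  have hspan : Submodule.span ℚ (Set.range x') = ⊤ := by
    have : Nonempty (Fin m₀) := ⟨⟨0, hm₀pos⟩⟩
    exact hli.span_eq_top_of_card_eq_finrank (by rw [Fintype.card_fin]; exact hm₀)
  have hx'L : ∀ i, x' i ∈ L := hxM
  apply hm₀8
  rw [hm₀]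
  apply eight_dvd_finrank q' (fun v hv => hqpos v (by simpa using hv)) L
  · rw [eq_top_iff, ← hspan]
    apply Submodule.span_mono
    rintro _ ⟨i, rfl⟩
    exact hx'L i
  · intro y hy
    exact hMint _ hy
  · intro y hy
    have hyσ : σ (y : V) = y := (hV₀ _).mp y.2
    have hyσk : ∀ k : ℕ, (σ ^ k) (y : V) = y := by
      intro k
      induction k with
      | zero => rfl
      | succ k ih => rw [pow_succ', LinearEquiv.mul_apply, ih, hyσ]
    have hpolσk : ∀ (k : ℕ) u v, QuadraticMap.polar q ((σ ^ k) u) ((σ ^ k) v) =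
        QuadraticMap.polar q u v := by
      intro k
      induction k with
      | zero => intro u v; rfl
      | succ k ih =>
        intro u v
        rw [pow_succ', LinearEquiv.mul_apply, LinearEquiv.mul_apply, hpolσ, ih]
    have hσkM : ∀ (k : ℕ) u, u ∈ M → (σ ^ k) u ∈ M := by
      intro k
      induction k with
      | zero => intro u hu; exact hu
      | succ k ih =>
        intro u hu
        rw [pow_succ', LinearEquiv.mul_apply]
        exact hσM _ (ih u hu)
    -- p • y ∈ M
    have hpy : (p : ℤ) • (y : V) ∈ M := by
      apply hMunimod
      intro z hz
      let t : V := ∑ k ∈ Finset.range p, (σ ^ k) z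
      have htM : t ∈ M := M.sum_mem fun k _ => hσkM k z hz
      have htσ : σ t = t := by
        have h1 : σ t = ∑ k ∈ Finset.range p, (σ ^ (k + 1)) z := by
          rw [map_sum]
          refine Finset.sum_congr rfl fun k _ => ?_
          rw [pow_succ', LinearEquiv.mul_apply]
        have h2 := Finset.sum_range_succ (fun k => (σ ^ k) z) p
        have h3 := Finset.sum_range_succ' (fun k => (σ ^ k) z) p
        rw [h1]
        rw [h2, hσp, pow_zero] at h3
        exact (add_right_cancel h3).symm
      obtain ⟨n, hn⟩ := hy ⟨t, (hV₀ _).mpr htσ⟩ htM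
      refine ⟨n, ?_⟩
      rw [← hn, hpol']
      change QuadraticMap.polarBilin q _ z = QuadraticMap.polarBilin q (y : V) t
      rw [map_sum]
      have h4 : ∀ k ∈ Finset.range p, QuadraticMap.polarBilin q (y : V) ((σ ^ k) z) =
          QuadraticMap.polarBilin q (y : V) z := by
        intro k _
        have := hpolσk k y z
        rw [hyσk] at this
        exact this
      rw [Finset.sum_congr rfl h4, Finset.sum_const, Finset.card_range, natCast_zsmul, map_nsmul]
      rfl
    -- det S • y ∈ M
    have hdy : S.det • (y : V) ∈ M := by
      have hyspan : y ∈ Submodule.span ℚ (Set.range x') := by rw [hspan]; trivial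
      obtain ⟨c, hc⟩ := (Submodule.mem_span_range_iff_exists_fun ℚ).mp hyspan
      choose z hz using fun j => hy (x' j) (hx'L j)
      have hz' : SQ.mulVec c = fun j => (z j : ℚ) := by
        funext j
        rw [← hgram, hc, ← hz, QuadraticMap.polar_comm]
        rfl
      have hadj : ∀ i, (S.det : ℚ) * c i = ((S.adjugate.mulVec z i : ℤ) : ℚ) := by
        intro i
        have h5 : SQ.adjugate.mulVec (SQ.mulVec c) = SQ.det • c := by
          rw [Matrix.mulVec_mulVec, Matrix.adjugate_mul, Matrix.smul_mulVec, Matrix.one_mulVec]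
        have h6 : SQ.adjugate = S.adjugate.map (Int.castRingHom ℚ) :=
          ((Int.castRingHom ℚ).map_adjugate S).symm
        have h7 := congrFun h5 i
        rw [hz', h6, hSQdet] at h7
        simp only [Pi.smul_apply, smul_eq_mul] at h7
        rw [← h7]
        simp [Matrix.mulVec, dotProduct]
      have h8 : S.det • (y : V) = ∑ i, (S.adjugate.mulVec z i) • x i := by
        have h9 : (y : V) = ∑ i, c i • x i := by
          rw [← hc]; simp [x']
        rw [h9, Finset.smul_sum]
        refine Finset.sum_congr rfl fun i _ => ?_
        rw [← Int.cast_smul_eq_zsmul ℚ, ← Int.cast_smul_eq_zsmul ℚ, smul_smul, hadj]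
      rw [h8]
      exact M.sum_mem fun i _ => M.smul_mem _ (hxM i)
    have hcop : IsCoprime (p : ℤ) S.det :=
      (Nat.prime_iff_prime_int.mp hp).coprime_iff_not_dvd.mpr hdiv
    obtain ⟨u, v, huv⟩ := hcop
    rw [hLmem]
    have h10 : (y : V) = u • ((p : ℤ) • (y : V)) + v • (S.det • (y : V)) := by
      rw [smul_smul, smul_smul, ← add_smul, huv, one_smul]
    rw [h10]
    exact M.add_mem (M.smul_mem _ hpy) (M.smul_mem _ hdy)
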